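/- arXiv:0909.4706 — 2 statements merged into one kernel-verified Lean document; each statement's English description precedes it below -/
import Mathlib

section
/- Let m be a natural number, η the (m+1)×(m+1) real Minkowski matrix, and H a positive semidefinite symmetric real (m+1)×(m+1) matrix. Then H − (1/2)·tr(ηH)·η = 0 if and only if H = 0. -/
/-- The `(m+1) × (m+1)` real Minkowski matrix `η = diag(-1, 1, …, 1)`. -/
def minkowski (m : ℕ) : Matrix (Fin (m + 1)) (Fin (m + 1)) ℝ :=
  Matrix.diagonal fun i => if i = 0 then -1 else 1

/-- For a positive semidefinite symmetric real `(m+1) × (m+1)`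
matrix `H`, the stress-energy tensor `T = H − (1/2)·tr(ηH)·η` of the wave-map
Lagrangian vanishes if and only if `H = 0`. -/
theorem wave_map_stress_energy_eq_zero_iff (m : ℕ)
    (H : Matrix (Fin (m + 1)) (Fin (m + 1)) ℝ) (hH : H.PosSemidef) :
    H - (1 / 2 * Matrix.trace (minkowski m * H)) • minkowski m = 0 ↔ H = 0 := by
  constructor
  · intro h
    have h1 := sub_eq_zero.mp h
    have ht : Matrix.trace (minkowski m * H) = - H 0 0 + ∑ i : Fin m, H i.succ i.succ := by
      simp [minkowski, Matrix.trace, Fin.sum_univ_succ]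
    have h0 : 0 ≤ H 0 0 := hH.diag_nonneg
    have hs : 0 ≤ ∑ i : Fin m, H i.succ i.succ :=
      Finset.sum_nonneg fun i _ => hH.diag_nonneg
    have h00 : H 0 0 = - (1 / 2 * Matrix.trace (minkowski m * H)) := by
      have := congrFun (congrFun h1 0) 0
      rw [Matrix.smul_apply] at this
      rw [this]
      simp [minkowski]
    have hc : Matrix.trace (minkowski m * H) = 0 := by linarith
    rw [h1, hc]
    simp
  · intro h
    simp [h]
end

section
/- Let m be a natural number and H a positive semidefinite symmetric real (m+1)×(m+1) matrix (indices running over {0,1,…,m}). Then the sum over i = 1,…,m of (H₀ᵢ)² is at most (tr H / 2)², i.e. Σ_{i=1}^{m} H₀ᵢ² ≤ (1/4)·(tr H)². -/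
/-- For a positive semidefinite symmetric real `(m+1) × (m+1)`
matrix `H` (rows and columns indexed by `{0, 1, …, m}`), the sum of the squares of
the off-diagonal entries `H₀ᵢ`, `i = 1, …, m`, is at most `(tr H / 2)²`. -/
theorem sum_sq_first_row_le_quarter_trace_sq (m : ℕ)
    (H : Matrix (Fin (m + 1)) (Fin (m + 1)) ℝ) (hH : H.PosSemidef) :
    ∑ i : Fin m, (H 0 i.succ) ^ 2 ≤ (Matrix.trace H / 2) ^ 2 := by
  have key : ∀ i : Fin m, (H 0 i.succ) ^ 2 ≤ H 0 0 * H i.succ i.succ := by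
    intro i
    have h := (hH.submatrix ![0, i.succ]).det_nonneg
    have hs : H i.succ 0 = H 0 i.succ := by
      simpa using hH.isHermitian.apply 0 i.succ
    rw [Matrix.det_fin_two] at h
    simp [hs] at h
    nlinarith
  have h1 : ∑ i : Fin m, (H 0 i.succ) ^ 2 ≤ H 0 0 * ∑ i : Fin m, H i.succ i.succ := by
    rw [Finset.mul_sum]
    exact Finset.sum_le_sum fun i _ => key i
  have ht : Matrix.trace H = H 0 0 + ∑ i : Fin m, H i.succ i.succ := by
    simp [Matrix.trace, Fin.sum_univ_succ]
  rw [ht]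
  nlinarith [sq_nonneg (H 0 0 - ∑ i : Fin m, H i.succ i.succ)]
end
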